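/- arXiv:1707.08689 — 6 statements merged into one kernel-verified Lean document; each statement's English description precedes it below -/
import Mathlib

section
/- Let G_S and G_T be nonzero rational functions in RatFunc ℝ (transfer functions of the continuous-time source and target systems). Assume G_T is BIBO stable (every complex root of the polynomial G_T.denom, mapped into ℂ, has negative real part) and G_S is minimum-phase (every complex root of G_S.denom and every complex root of G_S.num, mapped into ℂ, has negative real part). Then there exists a rational function G_α ∈ RatFunc ℝ that is causal (G_α.intDegree ≤ 0), BIBO stable (every complex root of G_α.denom has negative real part), and achieves perfect transfer learning (G_α * G_S = G_T), if and only if G_T.intDegree ≤ G_S.intDegree (equivalently, the relative degree of G_S is at most the relative degree of G_T). -/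
/-- Theorem 1 (continuous time): for BIBO-stable SISO LTI systems with
minimum-phase source, a causal, BIBO-stable perfect transfer learning map
exists iff the relative degree of the source is at most that of the target
(equivalently, `G_T.intDegree ≤ G_S.intDegree`). -/
theorem exists_causal_stable_perfect_TL_map_iff_continuous
    (G_S G_T : RatFunc ℝ) (hS : G_S ≠ 0) (hT : G_T ≠ 0)
    (hT_stable : ∀ z : ℂ, (G_T.denom.map (algebraMap ℝ ℂ)).IsRoot z → z.re < 0)
    (hS_den_stable : ∀ z : ℂ, (G_S.denom.map (algebraMap ℝ ℂ)).IsRoot z → z.re < 0)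
    (hS_num_stable : ∀ z : ℂ, (G_S.num.map (algebraMap ℝ ℂ)).IsRoot z → z.re < 0) :
    (∃ G_α : RatFunc ℝ,
        G_α.intDegree ≤ 0 ∧
        (∀ z : ℂ, (G_α.denom.map (algebraMap ℝ ℂ)).IsRoot z → z.re < 0) ∧
        G_α * G_S = G_T) ↔
      G_T.intDegree ≤ G_S.intDegree := by
  constructor
  · rintro ⟨G, hdeg, -, rfl⟩
    have hG : G ≠ 0 := left_ne_zero_of_mul hT
    rw [RatFunc.intDegree_mul hG hS]
    linarith
  · intro h
    refine ⟨G_T * G_S⁻¹, ?_, ?_, ?_⟩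
    · rw [RatFunc.intDegree_mul hT (inv_ne_zero hS), RatFunc.intDegree_inv]
      linarith
    · intro z hz
      have hd : (G_T * G_S⁻¹).denom ∣ G_T.denom * G_S.num :=
        (RatFunc.denom_mul_dvd _ _).trans (mul_dvd_mul_left _ (RatFunc.denom_inv_dvd hS))
      have h2 := hz.dvd (Polynomial.map_dvd (algebraMap ℝ ℂ) hd)
      rw [Polynomial.map_mul, Polynomial.IsRoot.def, Polynomial.eval_mul, mul_eq_zero] at h2
      rcases h2 with h2 | h2
      · exact hT_stable z h2
      · exact hS_num_stable z h2
    · exact inv_mul_cancel_right₀ hS G_T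
end

section
/- Let G_S, G_T be nonzero rational functions in RatFunc ℝ. Assume every complex root of G_T.denom (mapped into ℂ) has negative real part, every complex root of G_S.num (mapped into ℂ) has negative real part, and G_T.intDegree ≤ G_S.intDegree. Then the rational function G_α := G_T * G_S⁻¹ satisfies: (i) G_α * G_S = G_T (perfect transfer learning); (ii) G_α.intDegree ≤ 0 (causality); and (iii) every complex root of G_α.denom (mapped into ℂ) has negative real part (BIBO stability). -/
/-- Sufficiency direction of Theorem 1: under BIBO stability of the target
and minimum-phase source zeros, and `G_T.intDegree ≤ G_S.intDegree`,
the explicit map `G_α = G_T * G_S⁻¹` achieves perfect transfer learning,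
is causal, and is BIBO stable. -/
theorem optimal_TL_map_perfect_causal_stable
    (G_S G_T : RatFunc ℝ) (hS : G_S ≠ 0) (hT : G_T ≠ 0)
    (hT_stable : ∀ z : ℂ, (G_T.denom.map (algebraMap ℝ ℂ)).IsRoot z → z.re < 0)
    (hS_num_stable : ∀ z : ℂ, (G_S.num.map (algebraMap ℝ ℂ)).IsRoot z → z.re < 0)
    (h_deg : G_T.intDegree ≤ G_S.intDegree) :
    (G_T * G_S⁻¹) * G_S = G_T ∧
    (G_T * G_S⁻¹).intDegree ≤ 0 ∧
    (∀ z : ℂ, ((G_T * G_S⁻¹).denom.map (algebraMap ℝ ℂ)).IsRoot z → z.re < 0) := by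
  have h1 : (G_T * G_S⁻¹) * G_S = G_T := by
    rw [mul_assoc, inv_mul_cancel₀ hS, mul_one]
  refine ⟨h1, ?_, ?_⟩
  · have h2 := RatFunc.intDegree_mul (mul_ne_zero hT (inv_ne_zero hS)) hS
    rw [h1] at h2
    omega
  · intro z hz
    have hd : (G_T * G_S⁻¹).denom ∣ G_T.denom * G_S.num :=
      (RatFunc.denom_mul_dvd _ _).trans (mul_dvd_mul_left _ (RatFunc.denom_inv_dvd hS))
    have hr := hz.dvd (Polynomial.map_dvd (algebraMap ℝ ℂ) hd)
    rw [Polynomial.map_mul, Polynomial.root_mul] at hr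
    exact hr.elim (hT_stable z) (hS_num_stable z)
end

section
/- Let F and G be rational functions in RatFunc ℝ with G ≠ 0. If every complex root of F.denom (mapped into ℂ) has negative real part and every complex root of G.num (mapped into ℂ) has negative real part, then every complex root of (F * G⁻¹).denom (mapped into ℂ) has negative real part. -/
/-- Continuous-time stability of the optimal transfer map: if all complex
roots of `F.denom` and of `G.num` have negative real part, then so do all
complex roots of `(F * G⁻¹).denom`. -/
theorem denom_mul_inv_roots_re_neg (F G : RatFunc ℝ) (hG : G ≠ 0)
    (hF_den : ∀ z : ℂ, (F.denom.map (algebraMap ℝ ℂ)).IsRoot z → z.re < 0)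
    (hG_num : ∀ z : ℂ, (G.num.map (algebraMap ℝ ℂ)).IsRoot z → z.re < 0) :
    ∀ z : ℂ, ((F * G⁻¹).denom.map (algebraMap ℝ ℂ)).IsRoot z → z.re < 0 := by
  intro z hz
  have hd : (F * G⁻¹).denom ∣ F.denom * G.num :=
    (RatFunc.denom_mul_dvd F G⁻¹).trans (mul_dvd_mul_left _ (RatFunc.denom_inv_dvd hG))
  have h := hz.dvd (Polynomial.map_dvd (algebraMap ℝ ℂ) hd)
  rw [Polynomial.map_mul, Polynomial.root_mul] at h
  exact h.elim (hF_den z) (hG_num z)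
end

section
/- Let n be a nonempty finite index type, A : Matrix n n ℝ, and B, C : n → ℝ. Define the transfer function G ∈ RatFunc ℝ as the ratio of the polynomial Cᵀ · adjugate(charmatrix A) · B (i.e., the dot product of the vector (fun i => Polynomial.C (C i)) with (charmatrix A).adjugate.mulVec (fun i => Polynomial.C (B i))) over the characteristic polynomial charpoly A, where charmatrix A = X • 1 − A.map Polynomial.C; this realizes G(s) = C (sI − A)⁻¹ B. Let r ≥ 1 be a natural number such that C ⬝ᵥ ((A ^ k) *ᵥ B) = 0 for every k < r − 1 and C ⬝ᵥ ((A ^ (r−1)) *ᵥ B) ≠ 0. Then G ≠ 0 and G.intDegree = −r; that is, the relative degree of G equals the smallest r with C A^{r−1} B ≠ 0. -/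
open Matrix Polynomial

theorem aux_adj_natDegree {n : Type*} [Fintype n] [DecidableEq n]
    (A : Matrix n n ℝ) (i j : n) :
    ((charmatrix A).adjugate i j).natDegree ≤ Fintype.card n - 1 := by
  rw [Matrix.adjugate_apply, Matrix.det_apply']
  refine Polynomial.natDegree_sum_le_of_forall_le _ _ fun σ _ => ?_
  have h1 : ((((Equiv.Perm.sign σ : ℤˣ) : ℤ) : ℝ[X])).natDegree = 0 :=
    Polynomial.natDegree_intCast _
  refine Polynomial.natDegree_mul_le.trans ?_
  rw [h1, zero_add]
  refine (Polynomial.natDegree_prod_le _ _).trans ?_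
  have h2 : ∀ k : n, (((charmatrix A).updateRow j (Pi.single i 1)) (σ k) k).natDegree
      ≤ if k ∈ Finset.univ.erase (σ.symm j) then 1 else 0 := by
    intro k
    by_cases hk : σ k = j
    · have hk' : k = σ.symm j := by rw [← hk]; simp
      rw [hk, Matrix.updateRow_self]
      by_cases hki : k = i
      · subst hki; simp
      · simp [Pi.single_apply, hki]
    · have hk' : k ≠ σ.symm j := by
        rintro rfl; simp at hk
      rw [Matrix.updateRow_ne hk]
      simp only [Finset.mem_erase, ne_eq, hk', not_false_eq_true, Finset.mem_univ, and_self,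
        if_true]
      refine (charmatrix_apply_natDegree_le _ _).trans ?_
      split_ifs <;> simp
  refine (Finset.sum_le_sum fun k _ => h2 k).trans ?_
  rw [← Finset.sum_filter]
  simp [Finset.filter_ne', Finset.card_erase_of_mem]

theorem aux_degree {n : Type*} [Fintype n] [DecidableEq n] [Nonempty n]
    (A : Matrix n n ℝ) (v B : n → ℝ) :
    ((fun i => Polynomial.C (v i)) ⬝ᵥ
        ((charmatrix A).adjugate *ᵥ (fun i => Polynomial.C (B i)))).degree
      < A.charpoly.degree := by
  have hd : A.charpoly.degree = (Fintype.card n : ℕ) := Matrix.charpoly_degree_eq_dim A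
  have hpos : 0 < Fintype.card n := Fintype.card_pos
  have : ((fun i => Polynomial.C (v i)) ⬝ᵥ
        ((charmatrix A).adjugate *ᵥ (fun i => Polynomial.C (B i)))).natDegree
      ≤ Fintype.card n - 1 := by
    refine Polynomial.natDegree_sum_le_of_forall_le _ _ fun i _ => ?_
    refine (Polynomial.natDegree_C_mul_le _ _).trans ?_
    refine Polynomial.natDegree_sum_le_of_forall_le _ _ fun j _ => ?_
    exact (Polynomial.natDegree_mul_C_le _ _).trans (aux_adj_natDegree A i j)
  rw [hd]
  refine Polynomial.degree_le_natDegree.trans_lt ?_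
  exact_mod_cast (by omega)

theorem aux_step {n : Type*} [Fintype n] [DecidableEq n]
    (A : Matrix n n ℝ) (v B : n → ℝ) :
    (X : ℝ[X]) * ((fun i => Polynomial.C (v i)) ⬝ᵥ
        ((charmatrix A).adjugate *ᵥ (fun i => Polynomial.C (B i))))
      = ((fun i => Polynomial.C ((v ᵥ* A) i)) ⬝ᵥ
        ((charmatrix A).adjugate *ᵥ (fun i => Polynomial.C (B i))))
        + A.charpoly * Polynomial.C (v ⬝ᵥ B) := by
  have h := Matrix.mul_adjugate (charmatrix A)
  have h1 : (fun i => Polynomial.C ((v ᵥ* A) i)) =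
      (fun i => Polynomial.C (v i)) ᵥ* (A.map Polynomial.C) := by
    funext i; simp [Matrix.vecMul, dotProduct]
  have h2 : Polynomial.C (v ⬝ᵥ B) =
      (fun i => Polynomial.C (v i)) ⬝ᵥ (fun i => Polynomial.C (B i)) := by
    simp [dotProduct]
  have h3 : charmatrix A = (X : ℝ[X]) • (1 : Matrix n n ℝ[X]) - A.map Polynomial.C := by
    rw [charmatrix, Matrix.smul_one_eq_diagonal]; rfl
  rw [h1, h2, ← Matrix.dotProduct_mulVec]
  generalize (fun i => Polynomial.C (v i)) = w
  generalize (fun i => Polynomial.C (B i)) = b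
  have h4 : charmatrix A *ᵥ ((charmatrix A).adjugate *ᵥ b) = A.charpoly • b := by
    rw [Matrix.mulVec_mulVec, h, Matrix.smul_mulVec, Matrix.one_mulVec]; rfl
  generalize (charmatrix A).adjugate *ᵥ b = u at *
  rw [h3, Matrix.sub_mulVec, Matrix.smul_mulVec, Matrix.one_mulVec] at h4
  have h5 := congrArg (fun z => w ⬝ᵥ z) h4
  simp only [dotProduct_sub, dotProduct_smul, smul_eq_mul] at h5
  linear_combination h5

theorem aux_iter {n : Type*} [Fintype n] [DecidableEq n]
    (A : Matrix n n ℝ) (v B : n → ℝ) (m : ℕ)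
    (h : ∀ k < m, v ⬝ᵥ ((A ^ k) *ᵥ B) = 0) :
    (X : ℝ[X]) ^ m * ((fun i => Polynomial.C (v i)) ⬝ᵥ
        ((charmatrix A).adjugate *ᵥ (fun i => Polynomial.C (B i))))
      = ((fun i => Polynomial.C ((v ᵥ* A ^ m) i)) ⬝ᵥ
        ((charmatrix A).adjugate *ᵥ (fun i => Polynomial.C (B i)))) := by
  induction m with
  | zero => simp
  | succ m ih =>
    have h0 := h m (Nat.lt_succ_self m)
    rw [pow_succ', mul_assoc, ih (fun k hk => h k (by omega)), aux_step,
      ← Matrix.dotProduct_mulVec, h0, Matrix.vecMul_vecMul, ← pow_succ]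
    simp

/-- For a state-space realization `ẋ = Ax + Bu, y = Cx`, the transfer
function `G(s) = C (sI − A)⁻¹ B`, realized in `RatFunc ℝ` as the ratio of
`Cᵀ ⬝ adj(charmatrix A) ⬝ B` over `charpoly A`, has relative degree equal to
the smallest `r ≥ 1` with `C A^{r−1} B ≠ 0`: namely `G ≠ 0` and
`G.intDegree = −r`. -/
theorem transfer_function_intDegree_eq_neg_relative_degree
    {n : Type*} [Fintype n] [DecidableEq n] [Nonempty n]
    (A : Matrix n n ℝ) (B C : n → ℝ) (r : ℕ) (hr : 1 ≤ r)
    (h_zero : ∀ k < r - 1, C ⬝ᵥ ((A ^ k) *ᵥ B) = 0)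
    (h_ne : C ⬝ᵥ ((A ^ (r - 1)) *ᵥ B) ≠ 0)
    (N : Polynomial ℝ)
    (hN : N = (fun i => Polynomial.C (C i)) ⬝ᵥ
        ((charmatrix A).adjugate *ᵥ (fun i => Polynomial.C (B i))))
    (G : RatFunc ℝ)
    (hG : G = algebraMap (Polynomial ℝ) (RatFunc ℝ) N /
        algebraMap (Polynomial ℝ) (RatFunc ℝ) A.charpoly) :
    G ≠ 0 ∧ G.intDegree = -(r : ℤ) := by
  obtain ⟨m, rfl⟩ : ∃ m, r = m + 1 := ⟨r - 1, by omega⟩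
  simp only [Nat.add_sub_cancel] at h_zero h_ne
  have e1 := aux_iter A C B m h_zero
  rw [← hN] at e1
  have e2 := aux_step A (C ᵥ* A ^ m) B
  rw [← e1, ← Matrix.dotProduct_mulVec] at e2
  have hlt := aux_degree A ((C ᵥ* A ^ m) ᵥ* A) B
  have hχ : A.charpoly ≠ 0 := (Matrix.charpoly_monic A).ne_zero
  have e3 : (X * (X ^ m * N)).degree = A.charpoly.degree := by
    have hc : (A.charpoly * Polynomial.C (C ⬝ᵥ ((A ^ m) *ᵥ B))).degree = A.charpoly.degree :=
      Polynomial.degree_mul_C h_ne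
    rw [e2, Polynomial.degree_add_eq_right_of_degree_lt (by rw [hc]; exact hlt), hc]
  have hN0 : N ≠ 0 := by
    intro h0
    rw [h0] at e3
    simp only [mul_zero, Polynomial.degree_zero] at e3
    exact hχ (Polynomial.degree_eq_bot.mp e3.symm)
  have e4 : N.natDegree + (m + 1) = A.charpoly.natDegree := by
    have := Polynomial.natDegree_eq_of_degree_eq e3
    rw [← mul_assoc, ← pow_succ', Polynomial.natDegree_mul (pow_ne_zero _ X_ne_zero) hN0,
      Polynomial.natDegree_X_pow] at this
    omega
  have a1 : algebraMap ℝ[X] (RatFunc ℝ) N ≠ 0 := RatFunc.algebraMap_ne_zero hN0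
  have a2 : algebraMap ℝ[X] (RatFunc ℝ) A.charpoly ≠ 0 := RatFunc.algebraMap_ne_zero hχ
  subst hG
  refine ⟨div_ne_zero a1 a2, ?_⟩
  rw [RatFunc.intDegree_div a1 a2, RatFunc.intDegree_polynomial, RatFunc.intDegree_polynomial, ← e4]
  push_cast
  ring
end

section
/- Let n be a finite index type, A : Matrix n n ℝ, and B, C : n → ℝ. Then the polynomial p := dot product of (fun i => Polynomial.C (C i)) with (charmatrix A).adjugate.mulVec (fun i => Polynomial.C (B i)) (the numerator of C (sI − A)⁻¹ B before cancellation) has Polynomial.degree p < Fintype.card n, while charpoly A has degree exactly Fintype.card n. Hence the transfer function G(s) = C (sI − A)⁻¹ B is strictly proper: if G ≠ 0 in RatFunc ℝ then G.intDegree < 0, i.e., its relative degree is at least 1. -/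
open Matrix Polynomial

lemma adj_entry_mem {n : Type*} [Fintype n] [DecidableEq n] (A : Matrix n n ℝ) (i j : n) :
    (charmatrix A).adjugate i j ∈ Polynomial.degreeLT ℝ (Fintype.card n) := by
  rw [adjugate_apply, det_apply]
  refine Submodule.sum_mem _ fun σ _ => ?_
  have key : (∏ k, ((charmatrix A).updateRow j (Pi.single i 1)) (σ k) k) ∈
      Polynomial.degreeLT ℝ (Fintype.card n) := by
    rw [Polynomial.mem_degreeLT]
    refine lt_of_le_of_lt Polynomial.degree_le_natDegree ?_
    rw [Nat.cast_lt]
    refine lt_of_le_of_lt (Polynomial.natDegree_prod_le _ _) ?_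
    have hc : Fintype.card n = ∑ _k : n, 1 := by simp
    rw [hc]
    have h0 : ∀ k, (((charmatrix A).updateRow j (Pi.single i 1)) j k).natDegree = 0 := by
      intro k
      rw [updateRow_self]
      by_cases h : k = i
      · subst h; simp
      · simp [Pi.single_eq_of_ne h]
    refine Finset.sum_lt_sum (fun k _ => ?_) ⟨σ.symm j, Finset.mem_univ _, ?_⟩
    · by_cases h : σ k = j
      · rw [h, h0]; exact Nat.zero_le _
      · rw [updateRow_ne h]
        refine (charmatrix_apply_natDegree_le _ _).trans ?_
        split_ifs <;> simp
    · rw [Equiv.apply_symm_apply, h0]; exact Nat.one_pos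
  rcases Int.units_eq_one_or (Equiv.Perm.sign σ) with h | h
  · rw [h, one_smul]; exact key
  · rw [h, Units.neg_smul, one_smul]; exact Submodule.neg_mem _ key

/-- Strict properness of state-space transfer functions: the numerator
`Cᵀ ⬝ adj(charmatrix A) ⬝ B` has degree strictly below `card n`, the
characteristic polynomial has degree exactly `card n`, and hence the
transfer function `G = N / charpoly A`, if nonzero, has `intDegree < 0`
(relative degree at least 1). -/
theorem transfer_function_strictly_proper
    {n : Type*} [Fintype n] [DecidableEq n]
    (A : Matrix n n ℝ) (B C : n → ℝ)
    (N : Polynomial ℝ)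
    (hN : N = (fun i => Polynomial.C (C i)) ⬝ᵥ
        ((charmatrix A).adjugate *ᵥ (fun i => Polynomial.C (B i))))
    (G : RatFunc ℝ)
    (hG : G = algebraMap (Polynomial ℝ) (RatFunc ℝ) N /
        algebraMap (Polynomial ℝ) (RatFunc ℝ) A.charpoly) :
    N.degree < (Fintype.card n : WithBot ℕ) ∧
    A.charpoly.degree = (Fintype.card n : WithBot ℕ) ∧
    (G ≠ 0 → G.intDegree < 0) := by
  have h1 : N.degree < (Fintype.card n : WithBot ℕ) := by
    rw [← Polynomial.mem_degreeLT, hN]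
    refine Submodule.sum_mem _ fun i _ => ?_
    rw [← Polynomial.smul_eq_C_mul]
    refine Submodule.smul_mem _ _ (Submodule.sum_mem _ fun j _ => ?_)
    rw [mul_comm, ← Polynomial.smul_eq_C_mul]
    exact Submodule.smul_mem _ _ (adj_entry_mem A i j)
  have h2 := A.charpoly_degree_eq_dim
  refine ⟨h1, h2, fun h => ?_⟩
  subst hG
  obtain ⟨hn, hd⟩ := div_ne_zero_iff.mp h
  rw [RatFunc.intDegree_div hn hd, RatFunc.intDegree_polynomial, RatFunc.intDegree_polynomial]
  have hN0 : N ≠ 0 := by rintro rfl; simp at hn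
  have := Polynomial.natDegree_lt_natDegree hN0 (h1.trans_eq h2.symm)
  omega
end

section
/- Fix n : ℕ and let E := EuclideanSpace ℝ (Fin n). Let f, g : E → E and h : E → ℝ be smooth (ContDiff ℝ ⊤). Define the iterated Lie derivatives Lf : ℕ → (E → ℝ) recursively by Lf 0 = h and Lf (k+1) = fun p => fderiv ℝ (Lf k) p (f p). Let r ≥ 1 be a natural number and assume that for every k < r − 1 and every p ∈ E, fderiv ℝ (Lf k) p (g p) = 0 (i.e., L_g L_f^k h ≡ 0). Let u : ℝ → ℝ be smooth and let x : ℝ → E satisfy HasDerivAt x (f (x t) + u t • g (x t)) t for every t. Then for every t, iteratedDeriv r (h ∘ x) t = Lf r (x t) + (fderiv ℝ (Lf (r−1)) (x t) (g (x t))) * u t. -/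
/-- For the smooth control affine system `ẋ = f(x) + u g(x)`, `y = h(x)`,
with iterated Lie derivatives `Lf 0 = h`, `Lf (k+1) = D(Lf k)·f`, if
`L_g L_f^k h ≡ 0` for all `k < r − 1` (with `r ≥ 1`), then
`y^{(r)}(t) = L_f^r h(x(t)) + (L_g L_f^{r−1} h)(x(t)) · u(t)`. -/
theorem output_iteratedDeriv_control_affine
    (n : ℕ)
    (f g : EuclideanSpace ℝ (Fin n) → EuclideanSpace ℝ (Fin n))
    (h : EuclideanSpace ℝ (Fin n) → ℝ)
    (hf : ContDiff ℝ (⊤ : ℕ∞) f) (hg : ContDiff ℝ (⊤ : ℕ∞) g) (hh : ContDiff ℝ (⊤ : ℕ∞) h)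
    (Lf : ℕ → (EuclideanSpace ℝ (Fin n) → ℝ))
    (hLf0 : Lf 0 = h)
    (hLfsucc : ∀ k, Lf (k + 1) = fun p => fderiv ℝ (Lf k) p (f p))
    (r : ℕ) (hr : 1 ≤ r)
    (h_zero : ∀ k < r - 1, ∀ p : EuclideanSpace ℝ (Fin n), fderiv ℝ (Lf k) p (g p) = 0)
    (u : ℝ → ℝ) (hu : ContDiff ℝ (⊤ : ℕ∞) u)
    (x : ℝ → EuclideanSpace ℝ (Fin n))
    (hx : ∀ t : ℝ, HasDerivAt x (f (x t) + u t • g (x t)) t) :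
    ∀ t : ℝ, iteratedDeriv r (h ∘ x) t =
      Lf r (x t) + (fderiv ℝ (Lf (r - 1)) (x t) (g (x t))) * u t := by
  have hs : ∀ k, ContDiff ℝ (⊤ : ℕ∞) (Lf k) := by
    intro k
    induction k with
    | zero => rw [hLf0]; exact hh
    | succ k ih =>
      rw [hLfsucc]
      exact (ih.fderiv_right (m := ((⊤ : ℕ∞) : WithTop ℕ∞)) (by simp)).clm_apply hf
  have hd : ∀ k t, HasDerivAt (Lf k ∘ x)
      (Lf (k + 1) (x t) + (fderiv ℝ (Lf k) (x t) (g (x t))) * u t) t := by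
    intro k t
    have h1 : HasFDerivAt (Lf k) (fderiv ℝ (Lf k) (x t)) (x t) :=
      (((hs k).differentiable (by simp)) (x t)).hasFDerivAt
    have h2 := h1.comp_hasDerivAt t (hx t)
    rw [map_add, map_smul, smul_eq_mul, mul_comm (u t)] at h2
    rw [hLfsucc k]
    exact h2
  have hi : ∀ k, k ≤ r - 1 → iteratedDeriv k (h ∘ x) = Lf k ∘ x := by
    intro k
    induction k with
    | zero => intro _; rw [iteratedDeriv_zero, hLf0]
    | succ k ih =>
      intro hk
      rw [iteratedDeriv_succ, ih (by omega)]
      funext t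
      rw [(hd k t).deriv, h_zero k (by omega)]
      simp
  intro t
  obtain ⟨m, rfl⟩ : ∃ m, r = m + 1 := ⟨r - 1, by omega⟩
  rw [iteratedDeriv_succ, hi m (by omega), (hd m t).deriv]
  simp
end
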